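/- For $a\in(0,1/2]$ and $r\in(0,1)$ put $r'=\sqrt{1-r^2}$, $\mathcal K_a(r)=\frac{\pi}{2}F(a,1-a;1;r^2)$, where $F(a,b;c;x)=\sum_{k\ge 0}\frac{(a)_k(b)_k}{(c)_k\,k!}x^k$ ($|x|<1$) is the Gaussian hypergeometric function with $(a)_0=1$, $(a)_k=a(a+1)\cdots(a+k-1)$, and $\mu_a(r)=\frac{\pi}{2\sin(\pi a)}\cdot\frac{\mathcal K_a(r')}{\mathcal K_a(r)}$; $\mu_a$ is a strictly decreasing homeomorphism of $(0,1)$ onto $(0,\infty)$. For $K>0$ put $\varphi_K^a(r)=\mu_a^{-1}(\mu_a(r)/K)$, and for $x>0$ put $\eta_K^a(x)=(s/s')^2$, where $s=\varphi_K^a\big(\sqrt{x/(1+x)}\big)$ and $s'=\sqrt{1-s^2}$. Let $a\in(0,1/2]$, $K\ge 1$ and $0<m<n$. Then: (1) $\eta_K^a(mn)\le\sqrt{\eta_K^a(m^2)\,\eta_K^a(n^2)}$; (2) $(n/m)^{1/K}\le \dfrac{\eta_K^a(n)}{\eta_K^a(m)}\le (n/m)^K$, and both inequalities are strict if $K>1$;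 (3) $\eta_K^a(m)\,\eta_K^a(n)<\left(\eta_K^a\!\left(\frac{m+n}{2}\right)\right)^2$; (4) $\dfrac{2\,\eta_K^a(m)\,\eta_K^a(n)}{\eta_K^a(m)+\eta_K^a(n)}<\eta_K^a(\sqrt{mn})\le\sqrt{\eta_K^a(m)\,\eta_K^a(n)}$, and the second inequality is strict if $K>1$. -/

import Mathlib

/-- Generalized complete elliptic integral of the first kind
`𝒦ₐ(r) = (π/2) F(a, 1-a; 1; r²)`, with Mathlib's Gaussian hypergeometric function `₂F₁`. -/
noncomputable def ellK (a r : ℝ) : ℝ :=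
  Real.pi / 2 * ordinaryHypergeometric a (1 - a) (1 : ℝ) (r ^ 2)

/-- The generalized Grötzsch modulus `μₐ(r) = π / (2 sin(πa)) · 𝒦ₐ(r') / 𝒦ₐ(r)`, `r' = √(1-r²)`. -/
noncomputable def muFn (a r : ℝ) : ℝ :=
  Real.pi / (2 * Real.sin (Real.pi * a)) * (ellK a (Real.sqrt (1 - r ^ 2)) / ellK a r)

/-- Inverse of `μₐ : (0,1) → (0,∞)`. -/
noncomputable def muInv (a : ℝ) : ℝ → ℝ := Function.invFunOn (muFn a) (Set.Ioo 0 1)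

/-- The modular function `φ_K^a(r) = μₐ⁻¹(μₐ(r)/K)`. -/
noncomputable def phiK (a K r : ℝ) : ℝ := muInv a (muFn a r / K)

/-- `η_K^a(x) = (s/s')²` where `s = φ_K^a(√(x/(1+x)))` and `s' = √(1-s²)`. -/
noncomputable def etaK (a K x : ℝ) : ℝ :=
  (phiK a K (Real.sqrt (x / (1 + x))) /
    Real.sqrt (1 - phiK a K (Real.sqrt (x / (1 + x))) ^ 2)) ^ 2

open Real Set Filter Topology

/-! ### Power series with bounded coefficients -/

section PowerSeries

variable {c : ℕ → ℝ} {t : ℝ}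

lemma summable_mul_pow_of_abs_le (hc : ∀ k, |c k| ≤ k + 1) (ht : |t| < 1) :
    Summable fun k => c k * t ^ k := by
  have h1 := summable_pow_mul_geometric_of_norm_lt_one (R := ℝ) 1 (r := |t|) (by simpa using ht)
  have h2 := summable_pow_mul_geometric_of_norm_lt_one (R := ℝ) 0 (r := |t|) (by simpa using ht)
  refine Summable.of_norm_bounded (h1.add h2) fun k => ?_
  rw [norm_mul, norm_pow, Real.norm_eq_abs, Real.norm_eq_abs]
  have := mul_le_mul_of_nonneg_right (hc k) (pow_nonneg (abs_nonneg t) k)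
  simp only [pow_one, pow_zero, one_mul]
  linarith

lemma hasDerivAt_tsum_mul_pow (hc : ∀ k, |c k| ≤ 1) (ht : |t| < 1) :
    HasDerivAt (fun z => ∑' k, c k * z ^ k) (∑' k : ℕ, ((k + 1) * c (k + 1)) * t ^ k) t := by
  obtain ⟨ρ, htρ, hρ⟩ := exists_between ht
  have hρ0 : 0 < ρ := (abs_nonneg t).trans_lt htρ
  have hu : Summable fun k : ℕ => (k : ℝ) * ρ ^ (k - 1) := by
    rw [← summable_nat_add_iff 1]
    have := summable_mul_pow_of_abs_le (c := fun k => (k : ℝ) + 1) (t := ρ)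
      (fun k => (abs_of_nonneg (by positivity)).le) (by rwa [abs_of_pos hρ0])
    simpa using this
  have hmem : ∀ {z : ℝ}, z ∈ Ioo (-ρ) ρ ↔ |z| < ρ := fun {z} => by rw [abs_lt, mem_Ioo]
  have key := hasDerivAt_tsum_of_isPreconnected (𝕜 := ℝ) (F := ℝ) (t := Ioo (-ρ) ρ)
    (g := fun k z => c k * z ^ k) (g' := fun k z => c k * (k * z ^ (k - 1))) (y₀ := 0) (y := t)
    hu isOpen_Ioo isPreconnected_Ioo
    (fun k z _ => (hasDerivAt_pow k z).const_mul (c k)) (fun k z hz => ?_)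
    (by simp [hρ0])
    (summable_mul_pow_of_abs_le (fun k => (hc k).trans (by simp)) (by simp)) (hmem.2 htρ)
  · convert! key using 1
    have hs : Summable fun k : ℕ => c k * (k * t ^ (k - 1)) := by
      refine Summable.of_norm_bounded hu fun k => ?_
      rw [norm_mul, norm_mul, norm_pow, Real.norm_eq_abs, Real.norm_eq_abs, Real.norm_eq_abs,
        Nat.abs_cast]
      have : (k : ℝ) * |t| ^ (k - 1) ≤ k * ρ ^ (k - 1) := by gcongr
      calc _ ≤ 1 * ((k : ℝ) * |t| ^ (k - 1)) := by gcongr; exact hc k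
        _ ≤ _ := by linarith
    rw [hs.tsum_eq_zero_add]
    simp only [Nat.cast_zero, zero_mul, mul_zero, zero_add, Nat.cast_add, Nat.cast_one,
      Nat.add_sub_cancel]
    exact tsum_congr fun k => by ring
  · rw [norm_mul, norm_mul, norm_pow, Real.norm_eq_abs, Real.norm_eq_abs, Real.norm_eq_abs,
      Nat.abs_cast]
    have hz' := (hmem.1 hz).le
    have : (k : ℝ) * |z| ^ (k - 1) ≤ k * ρ ^ (k - 1) := by gcongr
    calc _ ≤ 1 * ((k : ℝ) * |z| ^ (k - 1)) := by gcongr; exact hc k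
      _ ≤ _ := by linarith

end PowerSeries

/-! ### The coefficients of `F(a, 1 - a; 1; ·)` -/

/-- The Taylor coefficients of `F(a, 1 - a; 1; ·)`. -/
noncomputable def hypCoeff (a : ℝ) (k : ℕ) : ℝ :=
  ordinaryHypergeometricCoefficient a (1 - a) (1 : ℝ) k

lemma hypCoeff_zero (a : ℝ) : hypCoeff a 0 = 1 := by
  simp [hypCoeff, ordinaryHypergeometricCoefficient]

lemma hypCoeff_succ (a : ℝ) (k : ℕ) :
    hypCoeff a (k + 1) * (k + 1) ^ 2 = hypCoeff a k * (k ^ 2 + k + a * (1 - a)) := by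
  have h1 : (Nat.factorial k : ℝ) ≠ 0 := by positivity
  have h2 : ((k : ℝ) + 1) ≠ 0 := by positivity
  have h3 : (1 + (k : ℝ)) ≠ 0 := by positivity
  simp only [hypCoeff, ordinaryHypergeometricCoefficient, ascPochhammer_succ_eval,
    ascPochhammer_eval_one, Nat.factorial_succ, Nat.cast_mul, Nat.cast_add, Nat.cast_one]
  field_simp
  ring

lemma mul_one_sub_pos {a : ℝ} (ha : a ∈ Ioo (0 : ℝ) 1) : 0 < a * (1 - a) :=
  mul_pos ha.1 (sub_pos.2 ha.2)

lemma mul_one_sub_le_quarter (a : ℝ) : a * (1 - a) ≤ 1 / 4 := by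
  nlinarith [sq_nonneg (a - 1 / 2)]

lemma hypCoeff_pos {a : ℝ} (ha : a ∈ Ioo (0 : ℝ) 1) (k : ℕ) : 0 < hypCoeff a k := by
  induction k with
  | zero => simp [hypCoeff_zero]
  | succ k ih =>
    have hw := mul_one_sub_pos ha
    have h : 0 < hypCoeff a (k + 1) * (k + 1) ^ 2 := by
      rw [hypCoeff_succ]; positivity
    exact pos_of_mul_pos_left h (by positivity)

lemma hypCoeff_le_one {a : ℝ} (ha : a ∈ Ioo (0 : ℝ) 1) (k : ℕ) : hypCoeff a k ≤ 1 := by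
  induction k with
  | zero => simp [hypCoeff_zero]
  | succ k ih =>
    have hw := mul_one_sub_le_quarter a
    have hp := hypCoeff_pos ha k
    have hk : (0 : ℝ) ≤ k := k.cast_nonneg
    have h := hypCoeff_succ a k
    have h2 : hypCoeff a k * (k ^ 2 + k + a * (1 - a)) ≤ 1 * (k + 1) ^ 2 := by
      have : (k : ℝ) ^ 2 + k + a * (1 - a) ≤ (k + 1) ^ 2 := by nlinarith
      have h0 : 0 ≤ (k : ℝ) ^ 2 + k + a * (1 - a) := by
        have := mul_one_sub_pos ha
        positivity
      exact mul_le_mul ih this h0 zero_le_one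
    rw [← h] at h2
    exact le_of_mul_le_mul_right h2 (by positivity)

lemma abs_hypCoeff_le_one {a : ℝ} (ha : a ∈ Ioo (0 : ℝ) 1) (k : ℕ) : |hypCoeff a k| ≤ 1 := by
  rw [abs_of_pos (hypCoeff_pos ha k)]
  exact hypCoeff_le_one ha k

lemma succ_mul_hypCoeff_succ (a : ℝ) (k : ℕ) :
    (k + 1) * hypCoeff a (k + 1) = k * hypCoeff a k + a * (1 - a) * (hypCoeff a k / (k + 1)) := by
  have h := hypCoeff_succ a k
  have h2 : ((k : ℝ) + 1) ≠ 0 := by positivity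
  field_simp
  linarith

lemma le_succ_mul_hypCoeff_succ {a : ℝ} (ha : a ∈ Ioo (0 : ℝ) 1) (k : ℕ) :
    a * (1 - a) ≤ (k + 1) * hypCoeff a (k + 1) := by
  induction k with
  | zero =>
    rw [succ_mul_hypCoeff_succ]
    simp [hypCoeff_zero]
  | succ k ih =>
    rw [succ_mul_hypCoeff_succ]
    have h1 := mul_one_sub_pos ha
    have h2 := hypCoeff_pos ha (k + 1)
    push_cast
    have : 0 < a * (1 - a) * (hypCoeff a (k + 1) / (k + 1 + 1)) := by positivity
    linarith

/-! ### The function `F(a, 1 - a; 1; ·)` and its derivatives -/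

/-- `F(a, 1 - a; 1; t)`. -/
noncomputable def hypF (a t : ℝ) : ℝ := ∑' k, hypCoeff a k * t ^ k

/-- `F(a, 1 - a; 2; t)`. -/
noncomputable def hypB (a t : ℝ) : ℝ := ∑' k : ℕ, hypCoeff a k / (k + 1) * t ^ k

lemma ordinaryHypergeometric_eq_hypF (a t : ℝ) :
    ordinaryHypergeometric a (1 - a) (1 : ℝ) t = hypF a t := by
  rw [ordinaryHypergeometric_eq_tsum]
  rfl

section HypF

variable {a t : ℝ}

lemma summable_hypF (ha : a ∈ Ioo (0 : ℝ) 1) (ht : |t| < 1) :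
    Summable fun k => hypCoeff a k * t ^ k :=
  summable_mul_pow_of_abs_le (fun k => (abs_hypCoeff_le_one ha k).trans (by simp)) ht

lemma hypCoeff_div_le (ha : a ∈ Ioo (0 : ℝ) 1) (k : ℕ) :
    hypCoeff a k / (k + 1) ≤ hypCoeff a k :=
  div_le_self (hypCoeff_pos ha k).le (by simp)

lemma abs_hypCoeff_div_le_one (ha : a ∈ Ioo (0 : ℝ) 1) (k : ℕ) :
    |hypCoeff a k / (k + 1)| ≤ 1 := by
  have := hypCoeff_pos ha k
  rw [abs_of_pos (by positivity)]
  exact (hypCoeff_div_le ha k).trans (hypCoeff_le_one ha k)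

lemma summable_hypB (ha : a ∈ Ioo (0 : ℝ) 1) (ht : |t| < 1) :
    Summable fun k : ℕ => hypCoeff a k / (k + 1) * t ^ k :=
  summable_mul_pow_of_abs_le (fun k => (abs_hypCoeff_div_le_one ha k).trans (by simp)) ht

lemma hypB_pos (ha : a ∈ Ioo (0 : ℝ) 1) (ht0 : 0 ≤ t) (ht1 : t < 1) : 0 < hypB a t := by
  have hs := summable_hypB ha (abs_lt.2 ⟨by linarith, ht1⟩)
  refine hs.tsum_pos (fun k => ?_) 0 ?_
  · have := hypCoeff_pos ha k
    positivity
  · simp [hypCoeff_zero]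

lemma hypB_le_hypF (ha : a ∈ Ioo (0 : ℝ) 1) (ht0 : 0 ≤ t) (ht1 : t < 1) :
    hypB a t ≤ hypF a t := by
  have ht : |t| < 1 := abs_lt.2 ⟨by linarith, ht1⟩
  exact (summable_hypB ha ht).tsum_le_tsum
    (fun k => mul_le_mul_of_nonneg_right (hypCoeff_div_le ha k) (pow_nonneg ht0 k))
    (summable_hypF ha ht)

lemma hypF_pos (ha : a ∈ Ioo (0 : ℝ) 1) (ht0 : 0 ≤ t) (ht1 : t < 1) : 0 < hypF a t :=
  (hypB_pos ha ht0 ht1).trans_le (hypB_le_hypF ha ht0 ht1)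

lemma hasDerivAt_hypF (ha : a ∈ Ioo (0 : ℝ) 1) (ht : |t| < 1) :
    HasDerivAt (hypF a) (a * (1 - a) * hypB a t / (1 - t)) t := by
  have h := hasDerivAt_tsum_mul_pow (abs_hypCoeff_le_one ha) ht
  have ht1 : 1 - t ≠ 0 := by linarith [(abs_lt.1 ht).2]
  have hs : Summable fun k : ℕ => (k : ℝ) * hypCoeff a k * t ^ k :=
    summable_mul_pow_of_abs_le (fun k => by
      have := hypCoeff_pos ha k
      rw [abs_of_nonneg (by positivity)]
      nlinarith [hypCoeff_le_one ha k, (Nat.cast_nonneg k : (0 : ℝ) ≤ k)]) ht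
  convert! h using 1
  rw [div_eq_iff ht1]
  set D := ∑' k : ℕ, ((k + 1) * hypCoeff a (k + 1)) * t ^ k with hD
  have h1 : D = ∑' k : ℕ, (k : ℝ) * hypCoeff a k * t ^ k + a * (1 - a) * hypB a t := by
    rw [hypB, ← tsum_mul_left, ← hs.tsum_add ((summable_hypB ha ht).mul_left _)]
    refine tsum_congr fun k => ?_
    rw [succ_mul_hypCoeff_succ]
    ring
  have h2 : ∑' k : ℕ, (k : ℝ) * hypCoeff a k * t ^ k = t * D := by
    rw [hs.tsum_eq_zero_add, hD, ← tsum_mul_left]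
    simp only [Nat.cast_zero, zero_mul, zero_add]
    refine tsum_congr fun k => ?_
    push_cast
    ring
  rw [h2] at h1
  linarith

lemma hasDerivAt_mul_hypB (ha : a ∈ Ioo (0 : ℝ) 1) (ht : |t| < 1) :
    HasDerivAt (fun z => z * hypB a z) (hypF a t) t := by
  let c : ℕ → ℝ := fun k => Nat.casesOn k 0 fun j => hypCoeff a j / (j + 1)
  have hc : ∀ k, |c k| ≤ 1 := by
    rintro (_ | k)
    · simp [c]
    · exact abs_hypCoeff_div_le_one ha k
  have h := hasDerivAt_tsum_mul_pow hc ht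
  have hF : ∑' k : ℕ, ((k + 1) * c (k + 1)) * t ^ k = hypF a t := by
    refine tsum_congr fun k => ?_
    have : ((k : ℝ) + 1) ≠ 0 := by positivity
    simp only [c]
    field_simp
  rw [hF] at h
  refine h.congr_of_eventuallyEq ?_
  have hnhds : ∀ᶠ z in 𝓝 t, |z| < 1 := continuous_abs.continuousAt.eventually_lt_const ht
  filter_upwards [hnhds] with z hz
  have hs : Summable fun k => c k * z ^ k :=
    summable_mul_pow_of_abs_le (fun k => (hc k).trans (by simp)) hz
  rw [hs.tsum_eq_zero_add, hypB, ← tsum_mul_left]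
  have h0 : c 0 = 0 := rfl
  rw [h0, zero_mul, zero_add]
  refine tsum_congr fun k => ?_
  simp only [c]
  ring

lemma neg_log_le_hypF (ha : a ∈ Ioo (0 : ℝ) 1) (ht0 : 0 ≤ t) (ht1 : t < 1) :
    a * (1 - a) * -log (1 - t) ≤ hypF a t := by
  have ht : |t| < 1 := abs_lt.2 ⟨by linarith, ht1⟩
  have hlog := (hasSum_pow_div_log_of_abs_lt_one ht).mul_left (a * (1 - a))
  have hs := summable_hypF ha ht
  rw [hypF, hs.tsum_eq_zero_add, ← hlog.tsum_eq]
  have hle : ∑' k : ℕ, a * (1 - a) * (t ^ (k + 1) / (k + 1)) ≤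
      ∑' k : ℕ, hypCoeff a (k + 1) * t ^ (k + 1) := by
    refine hlog.summable.tsum_le_tsum (fun k => ?_) ((summable_nat_add_iff 1).2 hs)
    have h := le_succ_mul_hypCoeff_succ ha k
    have hk : (0 : ℝ) < k + 1 := by positivity
    have hp := pow_nonneg ht0 (k + 1)
    rw [← mul_div_assoc, div_le_iff₀ hk]
    nlinarith
  simp only [hypCoeff_zero, pow_zero, mul_one]
  linarith

end HypF

/-! ### The logistic variable `t = eˣ / (1 + eˣ)` -/

/-- `F(a, 1 - a; 1; t)` in the variable `x = log (t / (1 - t))`. -/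
noncomputable def logitF (a x : ℝ) : ℝ := hypF a (sigmoid x)

/-- The derivative of `logitF`. -/
noncomputable def logitQ (a x : ℝ) : ℝ := a * (1 - a) * (sigmoid x * hypB a (sigmoid x))

section Logit

variable {a : ℝ}

lemma abs_sigmoid_lt_one (x : ℝ) : |sigmoid x| < 1 := by
  rw [abs_of_pos (sigmoid_pos x)]
  exact sigmoid_lt_one x

lemma logitF_pos (ha : a ∈ Ioo (0 : ℝ) 1) (x : ℝ) : 0 < logitF a x :=
  hypF_pos ha (sigmoid_nonneg x) (sigmoid_lt_one x)

lemma logitQ_pos (ha : a ∈ Ioo (0 : ℝ) 1) (x : ℝ) : 0 < logitQ a x :=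
  mul_pos (mul_one_sub_pos ha)
    (mul_pos (sigmoid_pos x) (hypB_pos ha (sigmoid_nonneg x) (sigmoid_lt_one x)))

lemma logitQ_le (ha : a ∈ Ioo (0 : ℝ) 1) (x : ℝ) :
    logitQ a x ≤ a * (1 - a) * (sigmoid x * logitF a x) := by
  have h := hypB_le_hypF ha (sigmoid_nonneg x) (sigmoid_lt_one x)
  have hw := (mul_one_sub_pos ha).le
  have hs := sigmoid_nonneg x
  unfold logitQ logitF
  gcongr

lemma hasDerivAt_logitF (ha : a ∈ Ioo (0 : ℝ) 1) (x : ℝ) :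
    HasDerivAt (logitF a) (logitQ a x) x := by
  have h := (hasDerivAt_hypF ha (abs_sigmoid_lt_one x)).comp x (hasDerivAt_sigmoid x)
  convert! h using 1
  have : 1 - sigmoid x ≠ 0 := by linarith [sigmoid_lt_one x]
  unfold logitQ
  field_simp

lemma hasDerivAt_logitQ (ha : a ∈ Ioo (0 : ℝ) 1) (x : ℝ) :
    HasDerivAt (logitQ a) (a * (1 - a) * (sigmoid x * sigmoid (-x) * logitF a x)) x := by
  have h := ((hasDerivAt_mul_hypB ha (abs_sigmoid_lt_one x)).comp x
    (hasDerivAt_sigmoid x)).const_mul (a * (1 - a))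
  convert! h using 1
  rw [sigmoid_neg, logitF]
  ring

lemma hasDerivAt_logitF_neg (ha : a ∈ Ioo (0 : ℝ) 1) (x : ℝ) :
    HasDerivAt (fun x => logitF a (-x)) (-logitQ a (-x)) x := by
  convert! (hasDerivAt_logitF ha (-x)).comp x (hasDerivAt_neg x) using 1
  simp

lemma hasDerivAt_logitQ_neg (ha : a ∈ Ioo (0 : ℝ) 1) (x : ℝ) :
    HasDerivAt (fun x => logitQ a (-x))
      (-(a * (1 - a) * (sigmoid (-x) * sigmoid x * logitF a (-x)))) x := by
  convert! (hasDerivAt_logitQ ha (-x)).comp x (hasDerivAt_neg x) using 1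
  simp

lemma logitF_strictMono (ha : a ∈ Ioo (0 : ℝ) 1) : StrictMono (logitF a) :=
  strictMono_of_hasDerivAt_pos (hasDerivAt_logitF ha) (logitQ_pos ha)

lemma tendsto_logitF_atTop (ha : a ∈ Ioo (0 : ℝ) 1) : Tendsto (logitF a) atTop atTop := by
  refine tendsto_atTop_mono (f := fun x => a * (1 - a) * x) (fun x => ?_)
    (tendsto_id.const_mul_atTop (mul_one_sub_pos ha))
  refine le_trans ?_ (neg_log_le_hypF ha (sigmoid_nonneg x) (sigmoid_lt_one x))
  refine mul_le_mul_of_nonneg_left ?_ (mul_one_sub_pos ha).le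
  rw [← sigmoid_neg, sigmoid_def, log_inv, neg_neg, neg_neg]
  exact (le_log_iff_exp_le (by positivity)).2 (by linarith)

/-- The Wronskian of `F(t)` and `F(1 - t)`, up to the factor `-t (1 - t)`. -/
noncomputable def logitW (a : ℝ) : ℝ := 2 * (logitQ a 0 * logitF a 0)

lemma logitW_pos (ha : a ∈ Ioo (0 : ℝ) 1) : 0 < logitW a :=
  mul_pos two_pos (mul_pos (logitQ_pos ha 0) (logitF_pos ha 0))

lemma wronskian_eq (ha : a ∈ Ioo (0 : ℝ) 1) (x : ℝ) :
    logitQ a x * logitF a (-x) + logitF a x * logitQ a (-x) = logitW a := by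
  have hd : ∀ x, HasDerivAt
      (fun x => logitQ a x * logitF a (-x) + logitF a x * logitQ a (-x)) 0 x := fun x => by
    convert! ((hasDerivAt_logitQ ha x).mul (hasDerivAt_logitF_neg ha x)).add
      ((hasDerivAt_logitF ha x).mul (hasDerivAt_logitQ_neg ha x)) using 1
    ring
  have h := is_const_of_deriv_eq_zero (fun x => (hd x).differentiableAt)
    (fun x => (hd x).deriv) x 0
  simp only [neg_zero] at h
  rw [h, logitW]
  ring

/-- `x ↦ F'(t) F(1 - t) t (1 - t)` is increasing. -/
lemma logitQ_mul_logitF_neg_strictMono (ha : a ∈ Ioo (0 : ℝ) 1) :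
    StrictMono fun x => logitQ a x * logitF a (-x) := by
  refine strictMono_of_hasDerivAt_pos
    (fun x => (hasDerivAt_logitQ ha x).mul (hasDerivAt_logitF_neg ha x)) fun x => ?_
  have hw := mul_one_sub_pos ha
  have hw' := mul_one_sub_le_quarter a
  have h1 := logitQ_le ha x
  have h2 := logitQ_le ha (-x)
  have hP : 0 < sigmoid x * logitF a x * (sigmoid (-x) * logitF a (-x)) :=
    mul_pos (mul_pos (sigmoid_pos _) (logitF_pos ha _))
      (mul_pos (sigmoid_pos _) (logitF_pos ha _))
  have h3 := mul_le_mul h1 h2 (logitQ_pos ha (-x)).le ((logitQ_pos ha x).le.trans h1)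
  have h4 : a * (1 - a) * (a * (1 - a)) * (sigmoid x * logitF a x * (sigmoid (-x) * logitF a (-x)))
      < a * (1 - a) * (sigmoid x * logitF a x * (sigmoid (-x) * logitF a (-x))) := by
    exact mul_lt_mul_of_pos_right (by nlinarith) hP
  linarith

lemma exp_neg_mul_logitF_sq_strictAnti (ha : a ∈ Ioo (0 : ℝ) 1) :
    StrictAnti fun x => exp (-x) * logitF a x ^ 2 := by
  refine strictAnti_of_hasDerivAt_neg (f' := fun x =>
    exp (-x) * logitF a x * (2 * logitQ a x - logitF a x)) (fun x => ?_) fun x => ?_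
  · have h1 : HasDerivAt (fun x => exp (-x)) (-exp (-x)) x := by
      simpa using (hasDerivAt_neg x).exp
    convert! h1.mul ((hasDerivAt_logitF ha x).pow 2) using 1
    simp only [Nat.cast_ofNat, Nat.add_one_sub_one, pow_one, Pi.pow_apply]
    ring
  · have hF := logitF_pos ha x
    refine mul_neg_of_pos_of_neg (mul_pos (exp_pos _) hF) ?_
    have h1 := logitQ_le ha x
    have hw' := mul_one_sub_le_quarter a
    have hw := mul_one_sub_pos ha
    have h2 : sigmoid x * logitF a x ≤ logitF a x :=
      mul_le_of_le_one_left hF.le (sigmoid_le_one x)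
    nlinarith [mul_le_mul_of_nonneg_left h2 hw.le]

/-! ### The logarithm of the modulus -/

/-- `log (F(1 - t) / F(t))` in the logistic variable. -/
noncomputable def logMod (a x : ℝ) : ℝ := log (logitF a (-x)) - log (logitF a x)

lemma hasDerivAt_logMod (ha : a ∈ Ioo (0 : ℝ) 1) (x : ℝ) :
    HasDerivAt (logMod a) (-(logitW a / (logitF a x * logitF a (-x)))) x := by
  have h1 := (logitF_pos ha x).ne'
  have h2 := (logitF_pos ha (-x)).ne'
  convert! ((hasDerivAt_logitF_neg ha x).log h2).sub ((hasDerivAt_logitF ha x).log h1) using 1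
  rw [← wronskian_eq ha x]
  field_simp
  ring

lemma logMod_strictAnti (ha : a ∈ Ioo (0 : ℝ) 1) : StrictAnti (logMod a) :=
  strictAnti_of_hasDerivAt_neg (hasDerivAt_logMod ha) fun x =>
    neg_neg_of_pos (div_pos (logitW_pos ha) (mul_pos (logitF_pos ha x) (logitF_pos ha (-x))))

lemma logMod_neg (a x : ℝ) : logMod a (-x) = -logMod a x := by
  simp [logMod]

lemma continuous_logMod (ha : a ∈ Ioo (0 : ℝ) 1) : Continuous (logMod a) :=
  continuous_iff_continuousAt.2 fun x => (hasDerivAt_logMod ha x).continuousAt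

lemma tendsto_logMod_atBot (ha : a ∈ Ioo (0 : ℝ) 1) : Tendsto (logMod a) atBot atTop := by
  have h1 : Tendsto (fun x => log (logitF a (-x)) + -log (logitF a 0)) atBot atTop :=
    tendsto_atTop_add_const_right _ _
      (tendsto_log_atTop.comp ((tendsto_logitF_atTop ha).comp tendsto_neg_atBot_atTop))
  refine tendsto_atTop_mono' _ ?_ h1
  filter_upwards [eventually_le_atBot 0] with x hx
  have := log_le_log (logitF_pos ha x) ((logitF_strictMono ha).monotone hx)
  unfold logMod
  linarith

lemma tendsto_logMod_atTop (ha : a ∈ Ioo (0 : ℝ) 1) : Tendsto (logMod a) atTop atBot := by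
  have h := tendsto_neg_atTop_atBot.comp ((tendsto_logMod_atBot ha).comp tendsto_neg_atTop_atBot)
  refine h.congr fun x => ?_
  simp [logMod_neg]

lemma logMod_surjective (ha : a ∈ Ioo (0 : ℝ) 1) : Function.Surjective (logMod a) :=
  (continuous_logMod ha).surjective' (tendsto_logMod_atBot ha) (tendsto_logMod_atTop ha)

end Logit

/-! ### The function `log ∘ η_K ∘ exp` -/

/-- `log (η_K^a (eˣ))`. -/
noncomputable def logEta (a K x : ℝ) : ℝ := Function.invFun (logMod a) (logMod a x - log K)

section LogEta

variable {a K : ℝ}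

lemma logMod_logEta (ha : a ∈ Ioo (0 : ℝ) 1) (x : ℝ) :
    logMod a (logEta a K x) = logMod a x - log K :=
  Function.invFun_eq (logMod_surjective ha _)

lemma logEta_one (ha : a ∈ Ioo (0 : ℝ) 1) (x : ℝ) : logEta a 1 x = x :=
  (logMod_strictAnti ha).injective (by rw [logMod_logEta ha, log_one, sub_zero])

lemma logEta_strictMono (ha : a ∈ Ioo (0 : ℝ) 1) : StrictMono (logEta a K) := fun x y hxy => by
  rw [← (logMod_strictAnti ha).lt_iff_gt, logMod_logEta ha, logMod_logEta ha]
  exact sub_lt_sub_right (logMod_strictAnti ha hxy) _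

lemma logEta_surjective (ha : a ∈ Ioo (0 : ℝ) 1) : Function.Surjective (logEta a K) := fun y => by
  obtain ⟨x, hx⟩ := logMod_surjective ha (logMod a y + log K)
  exact ⟨x, (logMod_strictAnti ha).injective (by rw [logMod_logEta ha, hx, add_sub_cancel_right])⟩

lemma continuous_logEta (ha : a ∈ Ioo (0 : ℝ) 1) : Continuous (logEta a K) :=
  (logEta_strictMono ha).monotone.continuous_of_surjective (logEta_surjective ha)

lemma lt_logEta (ha : a ∈ Ioo (0 : ℝ) 1) (hK : 1 < K) (x : ℝ) : x < logEta a K x := by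
  rw [← (logMod_strictAnti ha).lt_iff_gt, logMod_logEta ha]
  linarith [log_pos hK]

lemma exp_logMod (ha : a ∈ Ioo (0 : ℝ) 1) (x : ℝ) :
    exp (logMod a x) = logitF a (-x) / logitF a x := by
  rw [logMod, exp_sub, exp_log (logitF_pos ha _), exp_log (logitF_pos ha _)]

lemma logitF_logEta (ha : a ∈ Ioo (0 : ℝ) 1) (hK : 0 < K) (x : ℝ) :
    K * (logitF a (-logEta a K x) * logitF a x) = logitF a (-x) * logitF a (logEta a K x) := by
  have h := congrArg exp (logMod_logEta (K := K) ha x)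
  rw [exp_sub, exp_log hK, exp_logMod ha, exp_logMod ha] at h
  have h1 := (logitF_pos ha x).ne'
  have h2 := (logitF_pos ha (logEta a K x)).ne'
  field_simp at h
  linarith

lemma hasDerivAt_logEta (ha : a ∈ Ioo (0 : ℝ) 1) (x : ℝ) :
    HasDerivAt (logEta a K) (logitF a (logEta a K x) * logitF a (-logEta a K x) /
      (logitF a x * logitF a (-x))) x := by
  have hW := (logitW_pos ha).ne'
  have hF : ∀ x, logitF a x ≠ 0 := fun x => (logitF_pos ha x).ne'
  have h1 := hF x
  have h2 := hF (-x)
  have h3 := hF (logEta a K x)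
  have h4 := hF (-logEta a K x)
  have h := HasDerivAt.of_comp_left (continuous_logEta (K := K) ha).continuousAt
    (hasDerivAt_logMod ha (logEta a K x)) ((hasDerivAt_logMod ha x).sub_const (log K))
    (neg_ne_zero.2 (div_ne_zero hW (mul_ne_zero h3 h4)))
    (Eventually.of_forall fun y => logMod_logEta ha y)
  convert! h using 1
  field_simp

lemma hasDerivAt_logEta_left (ha : a ∈ Ioo (0 : ℝ) 1) (hK : 0 < K) (x : ℝ) :
    HasDerivAt (logEta a K) (K⁻¹ * (logitF a (logEta a K x) / logitF a x) ^ 2) x := by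
  convert! hasDerivAt_logEta (K := K) ha x using 1
  have h1 := (logitF_pos ha x).ne'
  have h2 := (logitF_pos ha (-x)).ne'
  have h := logitF_logEta ha hK x
  field_simp
  linear_combination -logitF a (logEta a K x) * h

lemma hasDerivAt_logEta_right (ha : a ∈ Ioo (0 : ℝ) 1) (hK : 0 < K) (x : ℝ) :
    HasDerivAt (logEta a K) (K * (logitF a (-logEta a K x) / logitF a (-x)) ^ 2) x := by
  convert! hasDerivAt_logEta (K := K) ha x using 1
  have h1 := (logitF_pos ha x).ne'
  have h2 := (logitF_pos ha (-x)).ne'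
  have h := logitF_logEta ha hK x
  field_simp
  linear_combination logitF a (-logEta a K x) * h

lemma logEta_sub_strictMono (ha : a ∈ Ioo (0 : ℝ) 1) (hK : 1 < K) :
    StrictMono fun x => logEta a K x - K⁻¹ * x := by
  have hK0 : 0 < K := by linarith
  refine strictMono_of_hasDerivAt_pos (fun x =>
    (hasDerivAt_logEta_left ha hK0 x).sub ((hasDerivAt_id x).const_mul K⁻¹)) fun x => ?_
  have h : 1 < logitF a (logEta a K x) / logitF a x :=
    (one_lt_div (logitF_pos ha x)).2 (logitF_strictMono ha (lt_logEta ha hK x))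
  have h2 : K⁻¹ * 1 < K⁻¹ * (logitF a (logEta a K x) / logitF a x) ^ 2 :=
    mul_lt_mul_of_pos_left (one_lt_pow₀ h two_ne_zero) (inv_pos.2 hK0)
  linarith

lemma sub_logEta_strictMono (ha : a ∈ Ioo (0 : ℝ) 1) (hK : 1 < K) :
    StrictMono fun x => K * x - logEta a K x := by
  have hK0 : 0 < K := by linarith
  refine strictMono_of_hasDerivAt_pos (fun x =>
    ((hasDerivAt_id x).const_mul K).sub (hasDerivAt_logEta_right ha hK0 x)) fun x => ?_
  have h0 : 0 ≤ logitF a (-logEta a K x) / logitF a (-x) :=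
    (div_pos (logitF_pos ha _) (logitF_pos ha _)).le
  have h : logitF a (-logEta a K x) / logitF a (-x) < 1 :=
    (div_lt_one (logitF_pos ha _)).2 (logitF_strictMono ha (neg_lt_neg (lt_logEta ha hK x)))
  have h2 : K * (logitF a (-logEta a K x) / logitF a (-x)) ^ 2 < K * 1 :=
    mul_lt_mul_of_pos_left (pow_lt_one₀ h0 h two_ne_zero) hK0
  linarith

lemma logitF_logEta_div_strictMono (ha : a ∈ Ioo (0 : ℝ) 1) (hK : 1 < K) :
    StrictMono fun x => logitF a (logEta a K x) / logitF a x := by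
  refine strictMono_of_hasDerivAt_pos (fun x =>
    ((hasDerivAt_logitF ha (logEta a K x)).comp x (hasDerivAt_logEta ha x)).div
      (hasDerivAt_logitF ha x) (logitF_pos ha x).ne') fun x => ?_
  have h1 := logitF_pos ha x
  have h2 := logitF_pos ha (-x)
  have h3 := logitF_pos ha (logEta a K x)
  refine div_pos ?_ (pow_pos h1 2)
  have hlt := logitQ_mul_logitF_neg_strictMono ha (lt_logEta ha hK x)
  have h4 : 0 < logitF a (logEta a K x) / logitF a (-x) *
      (logitQ a (logEta a K x) * logitF a (-logEta a K x) - logitQ a x * logitF a (-x)) :=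
    mul_pos (div_pos h3 h2) (sub_pos.2 hlt)
  convert! h4 using 1
  simp only [Function.comp_apply]
  field_simp

lemma strictConvexOn_logEta (ha : a ∈ Ioo (0 : ℝ) 1) (hK : 1 < K) :
    StrictConvexOn ℝ univ (logEta a K) := by
  have hK0 : 0 < K := by linarith
  refine StrictMono.strictConvexOn_univ_of_deriv (continuous_logEta ha) fun x y hxy => ?_
  rw [(hasDerivAt_logEta_left ha hK0 x).deriv, (hasDerivAt_logEta_left ha hK0 y).deriv]
  refine mul_lt_mul_of_pos_left (pow_lt_pow_left₀ (logitF_logEta_div_strictMono ha hK hxy)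
    (div_pos (logitF_pos ha _) (logitF_pos ha _)).le two_ne_zero) (inv_pos.2 hK0)

lemma strictConvexOn_exp_neg_logEta (ha : a ∈ Ioo (0 : ℝ) 1) (hK : 0 < K) :
    StrictConvexOn ℝ univ fun x => exp (-logEta a K x) := by
  have hd : ∀ x, HasDerivAt (fun x => exp (-logEta a K x))
      (-(K⁻¹ * (exp (-logEta a K x) * logitF a (logEta a K x) ^ 2 / logitF a x ^ 2))) x := by
    intro x
    convert! (hasDerivAt_logEta_left ha hK x).neg.exp using 1
    rw [div_pow]
    simp only [Pi.neg_apply]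
    ring
  refine StrictMono.strictConvexOn_univ_of_deriv
    (continuous_exp.comp (continuous_logEta ha).neg) fun x y hxy => ?_
  rw [(hd x).deriv, (hd y).deriv]
  refine neg_lt_neg (mul_lt_mul_of_pos_left ?_ (inv_pos.2 hK))
  have h1 := exp_neg_mul_logitF_sq_strictAnti ha (logEta_strictMono (K := K) ha hxy)
  have h2 := logitF_strictMono ha hxy
  have h3 := logitF_pos ha x
  have h4 := logitF_pos ha (logEta a K x)
  exact div_lt_div₀ h1 (by gcongr) (by positivity) (by positivity)

lemma strictConcaveOn_logEta_log (ha : a ∈ Ioo (0 : ℝ) 1) (hK : 0 < K) :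
    StrictConcaveOn ℝ (Ioi 0) fun x => logEta a K (log x) := by
  have hd : ∀ x ∈ Ioi (0 : ℝ), HasDerivAt (fun x => logEta a K (log x))
      (K * (logitF a (-logEta a K (log x)) ^ 2 /
        (exp (-(-log x)) * logitF a (-log x) ^ 2))) x := by
    intro x hx
    have hx : 0 < x := hx
    convert! (hasDerivAt_logEta_right ha hK (log x)).comp x (hasDerivAt_log hx.ne') using 1
    have := logitF_pos ha (-log x)
    rw [neg_neg, exp_log hx, div_pow]
    field_simp
  refine StrictAntiOn.strictConcaveOn_of_deriv (convex_Ioi 0)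
    (fun x hx => (hd x hx).continuousAt.continuousWithinAt) ?_
  rw [interior_Ioi]
  intro x hx y hy hxy
  rw [(hd x hx).deriv, (hd y hy).deriv]
  refine mul_lt_mul_of_pos_left ?_ hK
  have hlog : log x < log y := log_lt_log hx hxy
  have h1 := exp_neg_mul_logitF_sq_strictAnti ha (neg_lt_neg hlog)
  have h2 := logitF_strictMono ha (neg_lt_neg (logEta_strictMono (K := K) ha hlog))
  have h3 := logitF_pos ha (-log x)
  have h4 := logitF_pos ha (-logEta a K (log y))
  exact div_lt_div₀ (by gcongr) h1.le (by positivity) (by positivity)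

end LogEta

/-! ### Identification of `η_K^a` -/

section EtaK

variable {a K : ℝ}

lemma sigmoid_log {x : ℝ} (hx : 0 < x) : sigmoid (log x) = x / (1 + x) := by
  rw [sigmoid_def, exp_neg, exp_log hx]
  field_simp
  ring

lemma muFn_sqrt_sigmoid (ha : a ∈ Ioo (0 : ℝ) 1) (x : ℝ) :
    muFn a (√(sigmoid x)) = π / (2 * sin (π * a)) * exp (logMod a x) := by
  have h1 : (0 : ℝ) ≤ 1 - sigmoid x := by linarith [sigmoid_lt_one x]
  rw [muFn, ellK, ellK, sq_sqrt (sigmoid_nonneg x), sq_sqrt h1, ordinaryHypergeometric_eq_hypF,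
    ordinaryHypergeometric_eq_hypF, exp_logMod ha, ← sigmoid_neg, ← logitF, ← logitF,
    mul_div_mul_left _ _ (by positivity)]

lemma sqrt_sigmoid_mem (x : ℝ) : √(sigmoid x) ∈ Ioo (0 : ℝ) 1 :=
  ⟨sqrt_pos.2 (sigmoid_pos x), (sqrt_lt' one_pos).2 (by simpa using sigmoid_lt_one x)⟩

lemma exists_sqrt_sigmoid_eq {r : ℝ} (hr : r ∈ Ioo (0 : ℝ) 1) : ∃ x, √(sigmoid x) = r := by
  have h : r ^ 2 ∈ range sigmoid := by
    rw [range_sigmoid]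
    exact ⟨pow_pos hr.1 2, pow_lt_one₀ hr.1.le hr.2 two_ne_zero⟩
  obtain ⟨x, hx⟩ := h
  exact ⟨x, by rw [hx, sqrt_sq hr.1.le]⟩

lemma sin_pi_mul_pos (ha : a ∈ Ioo (0 : ℝ) 1) : 0 < sin (π * a) :=
  sin_pos_of_pos_of_lt_pi (mul_pos pi_pos ha.1) (mul_lt_of_lt_one_right pi_pos ha.2)

lemma muFn_injOn (ha : a ∈ Ioo (0 : ℝ) 1) : InjOn (muFn a) (Ioo 0 1) := by
  intro r hr s hs h
  obtain ⟨x, rfl⟩ := exists_sqrt_sigmoid_eq hr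
  obtain ⟨y, rfl⟩ := exists_sqrt_sigmoid_eq hs
  have hsin := sin_pi_mul_pos ha
  rw [muFn_sqrt_sigmoid ha, muFn_sqrt_sigmoid ha] at h
  have h' := mul_left_cancel₀ (by positivity) h
  rw [(logMod_strictAnti ha).injective (exp_injective h')]

lemma phiK_sqrt_sigmoid (ha : a ∈ Ioo (0 : ℝ) 1) (hK : 0 < K) (x : ℝ) :
    phiK a K (√(sigmoid x)) = √(sigmoid (logEta a K x)) := by
  have h : muFn a (√(sigmoid (logEta a K x))) = muFn a (√(sigmoid x)) / K := by
    rw [muFn_sqrt_sigmoid ha, muFn_sqrt_sigmoid ha, logMod_logEta ha, exp_sub, exp_log hK,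
      mul_div_assoc]
  have hex : ∃ r ∈ Ioo (0 : ℝ) 1, muFn a r = muFn a (√(sigmoid x)) / K :=
    ⟨_, sqrt_sigmoid_mem _, h⟩
  exact muFn_injOn ha (Function.invFunOn_mem hex) (sqrt_sigmoid_mem _)
    ((Function.invFunOn_eq hex).trans h.symm)

lemma etaK_eq (ha : a ∈ Ioo (0 : ℝ) 1) (hK : 0 < K) {x : ℝ} (hx : 0 < x) :
    etaK a K x = exp (logEta a K (log x)) := by
  rw [etaK, ← sigmoid_log hx, phiK_sqrt_sigmoid ha hK]
  set y := logEta a K (log x)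
  have h1 : 0 ≤ sigmoid (-y) := sigmoid_nonneg _
  rw [div_pow, sq_sqrt (sigmoid_nonneg y), ← sigmoid_neg, sq_sqrt h1, ← sigmoid_mul_rexp_neg,
    exp_neg]
  have := (sigmoid_pos y).ne'
  field_simp

end EtaK

/-! ### Inequalities for `η_K^a` -/

section Inequalities

variable {a K m n : ℝ}

lemma etaK_one (ha : a ∈ Ioo (0 : ℝ) 1) {x : ℝ} (hx : 0 < x) : etaK a 1 x = x := by
  rw [etaK_eq ha one_pos hx, logEta_one ha, exp_log hx]

lemma etaK_pos (ha : a ∈ Ioo (0 : ℝ) 1) (hK : 0 < K) {x : ℝ} (hx : 0 < x) : 0 < etaK a K x := by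
  rw [etaK_eq ha hK hx]
  exact exp_pos _

lemma log_sqrt_mul (hm : 0 < m) (hn : 0 < n) : log (√(m * n)) = (log m + log n) / 2 := by
  rw [log_sqrt (mul_pos hm hn).le, log_mul hm.ne' hn.ne']

lemma etaK_sqrt_mul_lt (ha : a ∈ Ioo (0 : ℝ) 1) (hK : 1 < K) (hm : 0 < m) (hmn : m < n) :
    etaK a K (√(m * n)) < √(etaK a K m * etaK a K n) := by
  have hn := hm.trans hmn
  have hK0 : 0 < K := by linarith
  rw [etaK_eq ha hK0 (sqrt_pos.2 (mul_pos hm hn)), etaK_eq ha hK0 hm, etaK_eq ha hK0 hn,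
    ← exp_add, ← exp_half, exp_lt_exp, log_sqrt_mul hm hn]
  have h := (strictConvexOn_logEta ha hK).2 (mem_univ (log m)) (mem_univ (log n))
    (log_lt_log hm hmn).ne (half_pos one_pos) (half_pos one_pos) (add_halves 1)
  simp only [smul_eq_mul] at h
  rw [show (log m + log n) / 2 = 1 / 2 * log m + 1 / 2 * log n by ring]
  linarith

lemma etaK_sqrt_mul_le (ha : a ∈ Ioo (0 : ℝ) 1) (hK : 1 ≤ K) (hm : 0 < m) (hmn : m < n) :
    etaK a K (√(m * n)) ≤ √(etaK a K m * etaK a K n) := by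
  rcases hK.eq_or_lt with rfl | hK
  · have hn := hm.trans hmn
    rw [etaK_one ha (sqrt_pos.2 (mul_pos hm hn)), etaK_one ha hm, etaK_one ha hn]
  · exact (etaK_sqrt_mul_lt ha hK hm hmn).le

lemma etaK_div (ha : a ∈ Ioo (0 : ℝ) 1) (hK : 0 < K) (hm : 0 < m) (hn : 0 < n) :
    etaK a K n / etaK a K m = exp (logEta a K (log n) - logEta a K (log m)) := by
  rw [etaK_eq ha hK hm, etaK_eq ha hK hn, exp_sub]

lemma rpow_lt_etaK_div (ha : a ∈ Ioo (0 : ℝ) 1) (hK : 1 < K) (hm : 0 < m) (hmn : m < n) :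
    (n / m) ^ (1 / K) < etaK a K n / etaK a K m := by
  have hn := hm.trans hmn
  rw [etaK_div ha (by linarith) hm hn, rpow_def_of_pos (div_pos hn hm), exp_lt_exp,
    log_div hn.ne' hm.ne', one_div]
  have := logEta_sub_strictMono ha hK (log_lt_log hm hmn)
  simp only at this
  linarith

lemma etaK_div_lt_rpow (ha : a ∈ Ioo (0 : ℝ) 1) (hK : 1 < K) (hm : 0 < m) (hmn : m < n) :
    etaK a K n / etaK a K m < (n / m) ^ K := by
  have hn := hm.trans hmn
  rw [etaK_div ha (by linarith) hm hn, rpow_def_of_pos (div_pos hn hm), exp_lt_exp,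
    log_div hn.ne' hm.ne']
  have := sub_logEta_strictMono ha hK (log_lt_log hm hmn)
  simp only at this
  linarith

lemma etaK_div_bounds (ha : a ∈ Ioo (0 : ℝ) 1) (hK : 1 ≤ K) (hm : 0 < m) (hmn : m < n) :
    (n / m) ^ (1 / K) ≤ etaK a K n / etaK a K m ∧ etaK a K n / etaK a K m ≤ (n / m) ^ K := by
  rcases hK.eq_or_lt with rfl | hK
  · simp [etaK_one ha hm, etaK_one ha (hm.trans hmn)]
  · exact ⟨(rpow_lt_etaK_div ha hK hm hmn).le, (etaK_div_lt_rpow ha hK hm hmn).le⟩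

lemma etaK_mul_lt_sq (ha : a ∈ Ioo (0 : ℝ) 1) (hK : 0 < K) (hm : 0 < m) (hmn : m < n) :
    etaK a K m * etaK a K n < etaK a K ((m + n) / 2) ^ 2 := by
  have hn := hm.trans hmn
  rw [etaK_eq ha hK hm, etaK_eq ha hK hn, etaK_eq ha hK (by positivity), ← exp_add, ← exp_nat_mul,
    exp_lt_exp]
  have h := (strictConcaveOn_logEta_log ha hK).2 (mem_Ioi.2 hm) (mem_Ioi.2 hn) hmn.ne
    (half_pos one_pos) (half_pos one_pos) (add_halves 1)
  simp only [smul_eq_mul] at h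
  rw [show (m + n) / 2 = 1 / 2 * m + 1 / 2 * n by ring]
  push_cast
  linarith

lemma harmonic_mean_etaK_lt (ha : a ∈ Ioo (0 : ℝ) 1) (hK : 0 < K) (hm : 0 < m) (hmn : m < n) :
    2 * (etaK a K m * etaK a K n) / (etaK a K m + etaK a K n) < etaK a K (√(m * n)) := by
  have hn := hm.trans hmn
  have hs := sqrt_pos.2 (mul_pos hm hn)
  have h := (strictConvexOn_exp_neg_logEta ha hK).2 (mem_univ (log m)) (mem_univ (log n))
    (log_lt_log hm hmn).ne (half_pos one_pos) (half_pos one_pos) (add_halves 1)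
  simp only [smul_eq_mul] at h
  rw [show 1 / 2 * log m + 1 / 2 * log n = log (√(m * n)) by rw [log_sqrt_mul hm hn]; ring,
    exp_neg, exp_neg, exp_neg, ← etaK_eq ha hK hs, ← etaK_eq ha hK hm, ← etaK_eq ha hK hn] at h
  have h1 := etaK_pos ha hK hm
  have h2 := etaK_pos ha hK hn
  have h3 := etaK_pos ha hK hs
  rw [div_lt_iff₀ (by positivity)]
  field_simp at h
  linarith

end Inequalities

theorem stmt11 (a : ℝ) (ha : a ∈ Set.Ioc (0 : ℝ) (1 / 2)) (K : ℝ) (hK : 1 ≤ K)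
    (m n : ℝ) (hm : 0 < m) (hmn : m < n) :
    -- (1)
    etaK a K (m * n) ≤ Real.sqrt (etaK a K (m ^ 2) * etaK a K (n ^ 2)) ∧
    -- (2), strict as soon as `K > 1`
    (((n / m) ^ (1 / K) ≤ etaK a K n / etaK a K m ∧
        etaK a K n / etaK a K m ≤ (n / m) ^ K) ∧
      (1 < K →
        (n / m) ^ (1 / K) < etaK a K n / etaK a K m ∧
        etaK a K n / etaK a K m < (n / m) ^ K)) ∧
    -- (3)
    etaK a K m * etaK a K n < etaK a K ((m + n) / 2) ^ 2 ∧
    -- (4), the second inequality strict as soon as `K > 1`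
    2 * (etaK a K m * etaK a K n) / (etaK a K m + etaK a K n) < etaK a K (Real.sqrt (m * n)) ∧
    etaK a K (Real.sqrt (m * n)) ≤ Real.sqrt (etaK a K m * etaK a K n) ∧
    (1 < K → etaK a K (Real.sqrt (m * n)) < Real.sqrt (etaK a K m * etaK a K n)) := by
  have ha' : a ∈ Ioo (0 : ℝ) 1 := ⟨ha.1, by linarith [ha.2]⟩
  have hK0 : 0 < K := by linarith
  refine ⟨?_, ⟨etaK_div_bounds ha' hK hm hmn, fun hK1 =>
    ⟨rpow_lt_etaK_div ha' hK1 hm hmn, etaK_div_lt_rpow ha' hK1 hm hmn⟩⟩,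
    etaK_mul_lt_sq ha' hK0 hm hmn, harmonic_mean_etaK_lt ha' hK0 hm hmn,
    etaK_sqrt_mul_le ha' hK hm hmn, fun hK1 => etaK_sqrt_mul_lt ha' hK1 hm hmn⟩
  have h := etaK_sqrt_mul_le ha' hK (pow_pos hm 2)
    (pow_lt_pow_left₀ hmn hm.le two_ne_zero : m ^ 2 < n ^ 2)
  rwa [← mul_pow, sqrt_sq (mul_pos hm (hm.trans hmn)).le] at h
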